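/- For a fixed complex number z, as n → ∞ the Bernoulli polynomial satisfies B_n(z) = (2(−1)^{n+1} n!/(2π)^n) · [cos(2πz + πn/2) + O(2^{−n})]. -/

import Mathlib

open scoped Real

lemma aux_tail (u : ℂ) (n : ℕ) :
    ‖Complex.exp u - ∑ k ∈ Finset.range (n + 1), u ^ k / (Nat.factorial k : ℂ)‖
      ≤ Real.exp (2 * ‖u‖) * (1 / 2) ^ n := by
  have h1 : HasSum (fun k : ℕ => u ^ k / (Nat.factorial k : ℂ)) (Complex.exp u) := by
    rw [Complex.exp_eq_exp_ℂ]
    exact NormedSpace.expSeries_div_hasSum_exp u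
  have h2 : HasSum (fun k : ℕ => (2 * ‖u‖) ^ k / (Nat.factorial k : ℝ)) (Real.exp (2 * ‖u‖)) := by
    rw [Real.exp_eq_exp_ℝ]
    exact NormedSpace.expSeries_div_hasSum_exp (2 * ‖u‖)
  have h3 := (hasSum_nat_add_iff' (n + 1)).2 h1
  have h4 := ((hasSum_nat_add_iff' (n + 1)).2 h2).mul_right ((1 / 2 : ℝ) ^ n)
  rw [← h3.tsum_eq]
  refine (tsum_of_norm_bounded h4 ?_).trans ?_
  · intro k
    rw [norm_div, norm_pow, Complex.norm_natCast, mul_pow, div_mul_eq_mul_div]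
    gcongr
    have : (1 : ℝ) ≤ 2 ^ (k + (n + 1)) * (1 / 2) ^ n := by
      rw [show k + (n + 1) = (k + 1) + n by ring, pow_add, mul_assoc, ← mul_pow]
      norm_num
      exact one_le_pow₀ (by norm_num)
    nlinarith [pow_nonneg (norm_nonneg u) (k + (n + 1))]
  · gcongr
    have : 0 ≤ ∑ k ∈ Finset.range (n + 1), (2 * ‖u‖) ^ k / (Nat.factorial k : ℝ) :=
      Finset.sum_nonneg fun _ _ => by positivity
    linarith

lemma aux_num : ∃ K : ℝ, 0 ≤ K ∧ ∀ k : ℕ,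
    ‖(2 * (π : ℂ) * Complex.I) ^ k * (bernoulli k : ℂ) / (Nat.factorial k : ℂ) + (1 + (-1) ^ k)‖
      ≤ K * (1 / 2) ^ k := by
  set c : ℕ → ℂ := fun k =>
    (2 * (π : ℂ) * Complex.I) ^ k * (bernoulli k : ℂ) / (Nat.factorial k : ℂ) + (1 + (-1) ^ k)
    with hc
  have hs : Summable (fun n : ℕ => 1 / ((n : ℝ) + 2) ^ 2) := by
    have := (summable_nat_add_iff 2).2 (Real.summable_one_div_nat_pow.2 (one_lt_two))
    simpa using this
  set S := ∑' n : ℕ, 1 / ((n : ℝ) + 2) ^ 2 with hS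
  have hS0 : 0 ≤ S := tsum_nonneg fun _ => by positivity
  have key : ∀ k, 2 ≤ k → ‖c k‖ ≤ 8 * S * (1 / 2) ^ k := by
    intro k hk
    have h := hasSum_one_div_nat_pow_mul_fourier hk (x := 0) (by simp)
    have h' := (hasSum_nat_add_iff' 2).2 h
    have e : c k = -(∑' n : ℕ, (1 : ℂ) / ((n + 2 : ℕ) : ℂ) ^ k * (1 + (-1) ^ k)) := by
      have := h'.tsum_eq
      simp only [fourier_apply, Finset.sum_range_succ] at this
      simp [bernoulliFun_eval_zero, show k ≠ 0 by omega] at this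
      simp only [hc]
      push_cast
      simp only [one_div]
      rw [this]
      ring
    rw [e, norm_neg]
    refine tsum_of_norm_bounded (hs.hasSum.mul_left (8 * (1 / 2 : ℝ) ^ k)) ?_ |>.trans ?_
    · intro n
      have h2 : ‖(1 : ℂ) + (-1) ^ k‖ ≤ 2 := by
        refine (norm_add_le _ _).trans ?_
        simp; norm_num
      rw [norm_mul, norm_div, norm_pow, Complex.norm_natCast, norm_one]
      obtain ⟨m, rfl⟩ := Nat.exists_eq_add_of_le hk
      have h3 : (1 : ℝ) / ((n + 2 : ℕ) : ℝ) ^ (2 + m) ≤ (1 / 2) ^ m * (1 / ((n : ℝ) + 2) ^ 2) := by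
        push_cast
        rw [pow_add, one_div_pow, one_div_mul_one_div, mul_comm]
        gcongr
        linarith [(Nat.cast_nonneg n : (0 : ℝ) ≤ n)]
      calc _ ≤ ((1 / 2) ^ m * (1 / ((n : ℝ) + 2) ^ 2)) * 2 := by gcongr
        _ = _ := by rw [pow_add]; ring
    · rw [← hS]; apply le_of_eq; ring
  refine ⟨8 * S + ‖c 0‖ + 2 * ‖c 1‖, by positivity, fun k => ?_⟩
  change ‖c k‖ ≤ _
  rcases Nat.lt_or_ge k 2 with hk | hk
  · interval_cases k
    · simp only [pow_zero]; linarith [norm_nonneg (c 1)]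
    · simp only [pow_one]; linarith [norm_nonneg (c 0)]
  · refine (key k hk).trans ?_
    gcongr
    linarith [norm_nonneg (c 0), norm_nonneg (c 1)]

lemma aux_expand (z w : ℂ) (n : ℕ) :
    w ^ n * Polynomial.aeval z (Polynomial.bernoulli n) / (Nat.factorial n : ℂ) =
      ∑ k ∈ Finset.range (n + 1),
        (w ^ (n - k) * (bernoulli (n - k) : ℂ) / (Nat.factorial (n - k) : ℂ)) *
          ((w * z) ^ k / (Nat.factorial k : ℂ)) := by
  rw [Polynomial.bernoulli_def, map_sum, Finset.mul_sum, Finset.sum_div]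
  refine Finset.sum_congr rfl fun k hk => ?_
  have hk' : k ≤ n := by simpa [Nat.lt_succ_iff] using hk
  rw [Polynomial.aeval_monomial]
  have h1 : (Nat.choose n k : ℂ) * Nat.factorial k * Nat.factorial (n - k) = Nat.factorial n := by
    exact_mod_cast Nat.choose_mul_factorial_mul_factorial hk'
  have h2 : w ^ n = w ^ (n - k) * w ^ k := by rw [← pow_add, Nat.sub_add_cancel hk']
  have f1 : (Nat.factorial n : ℂ) ≠ 0 := by exact_mod_cast Nat.factorial_ne_zero n
  have f2 : (Nat.factorial k : ℂ) ≠ 0 := by exact_mod_cast Nat.factorial_ne_zero k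
  have f3 : (Nat.factorial (n - k) : ℂ) ≠ 0 := by exact_mod_cast Nat.factorial_ne_zero (n - k)
  simp only [eq_ratCast, Rat.cast_mul, Rat.cast_natCast]
  rw [h2, mul_pow, div_mul_div_comm, div_eq_div_iff f1 (mul_ne_zero f3 f2), ← h1]
  ring

/-- For fixed complex `z`, as `n → ∞`,
`B_n(z) = (2(-1)^{n+1} n!/(2π)^n)[cos(2πz + πn/2) + O(2^{-n})]`, i.e.
`|B_n(z)(2π)^n/(2(-1)^{n+1} n!) - cos(2πz + πn/2)| ≤ C 2^{-n}` for a constant `C`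
depending only on `z`. -/
theorem stmt7 (z : ℂ) :
    ∃ C : ℝ, ∀ n : ℕ,
      ‖Polynomial.aeval z (Polynomial.bernoulli n) * (2 * (π : ℂ)) ^ n /
          (2 * (-1) ^ (n + 1) * (Nat.factorial n : ℂ)) -
        Complex.cos (2 * (π : ℂ) * z + (π : ℂ) * n / 2)‖ ≤ C * (1 / 2) ^ n := by
  obtain ⟨K, hK0, hK⟩ := aux_num
  set w : ℂ := 2 * (π : ℂ) * Complex.I with hw
  set u : ℂ := w * z with hu
  refine ⟨(K + 2) * Real.exp (2 * ‖u‖), fun n => ?_⟩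
  set S : ℂ := w ^ n * Polynomial.aeval z (Polynomial.bernoulli n) / (Nat.factorial n : ℂ) with hS
  have f1 : (Nat.factorial n : ℂ) ≠ 0 := by exact_mod_cast Nat.factorial_ne_zero n
  have hI : Complex.I ^ n ≠ 0 := pow_ne_zero _ Complex.I_ne_zero
  have hII : Complex.I ^ n * Complex.I ^ n = (-1) ^ n := by
    rw [← mul_pow, Complex.I_mul_I]
  have hm : ((-1 : ℂ) ^ n) * (-1) ^ n = 1 := by rw [← mul_pow]; simp
  have hcos : 2 * Complex.I ^ n * Complex.cos (2 * (π : ℂ) * z + (π : ℂ) * n / 2) =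
      (-1) ^ n * Complex.exp u + Complex.exp (-u) := by
    rw [Complex.cos]
    have e1 : Complex.exp ((2 * (π : ℂ) * z + (π : ℂ) * n / 2) * Complex.I)
        = Complex.exp u * Complex.I ^ n := by
      rw [show (2 * (π : ℂ) * z + (π : ℂ) * n / 2) * Complex.I
        = u + n * (π / 2 * Complex.I) by rw [hu, hw]; ring, Complex.exp_add, Complex.exp_nat_mul,
        Complex.exp_pi_div_two_mul_I]
    have e2 : Complex.exp (-(2 * (π : ℂ) * z + (π : ℂ) * n / 2) * Complex.I)
        = Complex.exp (-u) * (Complex.I ^ n)⁻¹ := by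
      rw [neg_mul, Complex.exp_neg, e1, mul_inv, Complex.exp_neg]
    rw [e1, e2]
    field_simp
    rw [sq, hII]; ring
  have hmain : Polynomial.aeval z (Polynomial.bernoulli n) * (2 * (π : ℂ)) ^ n /
          (2 * (-1) ^ (n + 1) * (Nat.factorial n : ℂ)) -
        Complex.cos (2 * (π : ℂ) * z + (π : ℂ) * n / 2)
      = -(S + (Complex.exp u + (-1) ^ n * Complex.exp (-u))) * (-1) ^ n / (2 * Complex.I ^ n) := by
    have h2 : (2 * Complex.I ^ n) ≠ 0 := mul_ne_zero two_ne_zero hI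
    rw [eq_div_iff h2, sub_mul, mul_comm (Complex.cos _), hcos, hS, hw, mul_pow _ Complex.I, pow_succ]
    have hm1 : ((-1 : ℂ) ^ n) ≠ 0 := pow_ne_zero _ (by norm_num)
    have : Polynomial.aeval z (Polynomial.bernoulli n) * (2 * (π : ℂ)) ^ n /
          (2 * ((-1) ^ n * -1) * (Nat.factorial n : ℂ)) = -((-1) ^ n *
          (Polynomial.aeval z (Polynomial.bernoulli n) * (2 * (π : ℂ)) ^ n) /
          (2 * (Nat.factorial n : ℂ))) := by
      rw [← neg_div, div_eq_div_iff (by simp [f1]) (by simp [f1])]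
      linear_combination (-4 * Polynomial.aeval z (Polynomial.bernoulli n) * (2 * (π : ℂ)) ^ n * (Nat.factorial n : ℂ) / 2) * hm
    rw [this]
    linear_combination (Complex.exp (-u)) * hm
  have hn1 : ‖((-1 : ℂ) ^ n)‖ = 1 := by simp
  have hnorm : ‖-(S + (Complex.exp u + (-1) ^ n * Complex.exp (-u))) * (-1) ^ n / (2 * Complex.I ^ n)‖
      = ‖S + (Complex.exp u + (-1) ^ n * Complex.exp (-u))‖ / 2 := by
    rw [norm_div, norm_mul, norm_neg, hn1]; simp
  rw [hmain, hnorm]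
  set d : ℕ → ℂ := fun k =>
    w ^ k * (bernoulli k : ℂ) / (Nat.factorial k : ℂ) + (1 + (-1) ^ k) with hd
  have hdec : S + (Complex.exp u + (-1) ^ n * Complex.exp (-u)) =
      (∑ k ∈ Finset.range (n + 1), d (n - k) * (u ^ k / (Nat.factorial k : ℂ))) +
      (Complex.exp u - ∑ k ∈ Finset.range (n + 1), u ^ k / (Nat.factorial k : ℂ)) +
      (-1) ^ n * (Complex.exp (-u) -
        ∑ k ∈ Finset.range (n + 1), (-u) ^ k / (Nat.factorial k : ℂ)) := by
    have : S = (∑ k ∈ Finset.range (n + 1), d (n - k) * (u ^ k / (Nat.factorial k : ℂ))) -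
        ∑ k ∈ Finset.range (n + 1), u ^ k / (Nat.factorial k : ℂ) -
        (-1) ^ n * ∑ k ∈ Finset.range (n + 1), (-u) ^ k / (Nat.factorial k : ℂ) := by
      rw [hS, aux_expand, Finset.mul_sum, ← Finset.sum_sub_distrib, ← Finset.sum_sub_distrib]
      refine Finset.sum_congr rfl fun k hk => ?_
      have hk' : k ≤ n := by simpa [Nat.lt_succ_iff] using hk
      have h3 : (-1 : ℂ) ^ n = (-1) ^ (n - k) * (-1) ^ k := by
        rw [← pow_add, Nat.sub_add_cancel hk']
      have h4 : ((-1 : ℂ) ^ k) * (-1) ^ k = 1 := by rw [← mul_pow]; simp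
      rw [h3, neg_pow u k, ← hu]
      simp only [hd]
      linear_combination ((-1) ^ (n - k) * u ^ k / (Nat.factorial k : ℂ)) * h4
    rw [this]; ring
  have b1 : ‖∑ k ∈ Finset.range (n + 1), d (n - k) * (u ^ k / (Nat.factorial k : ℂ))‖
      ≤ K * Real.exp (2 * ‖u‖) * (1 / 2) ^ n := by
    have h5 : ∑ k ∈ Finset.range (n + 1), (2 * ‖u‖) ^ k / (Nat.factorial k : ℝ)
      ≤ Real.exp (2 * ‖u‖) := Real.sum_le_exp_of_nonneg (by positivity) _
    calc _ ≤ ∑ k ∈ Finset.range (n + 1),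
          K * (1 / 2) ^ n * ((2 * ‖u‖) ^ k / (Nat.factorial k : ℝ)) := by
          refine norm_sum_le_of_le _ fun k hk => ?_
          have hk' : k ≤ n := by simpa [Nat.lt_succ_iff] using hk
          rw [norm_mul, norm_div, norm_pow, Complex.norm_natCast]
          have h6 : (1 / 2 : ℝ) ^ n * 2 ^ k = (1 / 2) ^ (n - k) := by
            have : (1 / 2 : ℝ) ^ n = (1 / 2) ^ (n - k) * (1 / 2) ^ k := by
              rw [← pow_add, Nat.sub_add_cancel hk']
            rw [this, mul_assoc, ← mul_pow]; norm_num
          calc _ ≤ K * (1 / 2) ^ (n - k) * (‖u‖ ^ k / (Nat.factorial k : ℝ)) := by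
                gcongr
                exact hK (n - k)
            _ = _ := by rw [← h6, mul_pow]; ring
      _ = K * (1 / 2) ^ n * ∑ k ∈ Finset.range (n + 1), (2 * ‖u‖) ^ k / (Nat.factorial k : ℝ) := by
          rw [Finset.mul_sum]
      _ ≤ K * (1 / 2) ^ n * Real.exp (2 * ‖u‖) := by gcongr
      _ = _ := by ring
  have b2 := aux_tail u n
  have b3 := aux_tail (-u) n
  rw [norm_neg] at b3
  have b4 := norm_add₃_le (a := ∑ k ∈ Finset.range (n + 1), d (n - k) * (u ^ k / (Nat.factorial k : ℂ)))
    (b := Complex.exp u - ∑ k ∈ Finset.range (n + 1), u ^ k / (Nat.factorial k : ℂ))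
    (c := (-1) ^ n * (Complex.exp (-u) -
        ∑ k ∈ Finset.range (n + 1), (-u) ^ k / (Nat.factorial k : ℂ)))
  rw [norm_mul, hn1, one_mul] at b4
  rw [hdec]
  have := norm_nonneg ((∑ k ∈ Finset.range (n + 1), d (n - k) * (u ^ k / (Nat.factorial k : ℂ))) +
      (Complex.exp u - ∑ k ∈ Finset.range (n + 1), u ^ k / (Nat.factorial k : ℂ)) +
      (-1) ^ n * (Complex.exp (-u) -
        ∑ k ∈ Finset.range (n + 1), (-u) ^ k / (Nat.factorial k : ℂ)))
  linarith
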